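/- Fix integers n ≥ 1 and m ≥ 1. For all integers i, j with 1 ≤ i, j ≤ m, the bilinear map ϱ_{i,j} : V0 × V1 → V1 defined on basis vectors by ϱ_{i,j}(X_0, Y_i) = Y_j, ϱ_{i,j}(X_0, Y_k) = 0 for k ≠ i, and ϱ_{i,j}(X_p, Y_k) = 0 for all 1 ≤ p ≤ n and 1 ≤ k ≤ m, is a ρ-cocycle of L_{n,m}. -/

import Mathlib

open Finset

noncomputable section

/-- The even part of `L_{n,m}`: `ℂ^{n+1}` with basis `X_0, …, X_n`. -/
abbrev V0 (n : ℕ) : Type := Fin (n + 1) → ℂ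

/-- The odd part of `L_{n,m}`: `ℂ^m` with basis `Y_1, …, Y_m`. -/
abbrev V1 (m : ℕ) : Type := Fin m → ℂ

/-- Basis vector `X_k` of `V0 n` for `0 ≤ k ≤ n`; zero for `k > n`. -/
def Xb (n k : ℕ) : V0 n := if h : k ≤ n then Pi.single (⟨k, by omega⟩ : Fin (n + 1)) 1 else 0

/-- `X_k`, with the convention that it denotes the zero vector for `k ≤ 0` or `k > n`. -/
def Xz (n : ℕ) (k : ℤ) : V0 n :=
  if h : 1 ≤ k ∧ k ≤ n then Pi.single (⟨k.toNat, by omega⟩ : Fin (n + 1)) 1 else 0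

/-- Basis vector `Y_k` of `V1 m` for `1 ≤ k ≤ m`; zero otherwise. -/
def Yb (m k : ℕ) : V1 m :=
  if h : 1 ≤ k ∧ k ≤ m then Pi.single (⟨k - 1, by omega⟩ : Fin m) 1 else 0

/-- The bilinear map determined by its values on the standard bases. -/
def bil {ι κ : Type} [Fintype ι] [DecidableEq ι] [Fintype κ] [DecidableEq κ]
    {M : Type} [AddCommGroup M] [Module ℂ M] (f : ι → κ → M) :
    (ι → ℂ) →ₗ[ℂ] (κ → ℂ) →ₗ[ℂ] M :=
  LinearMap.mk₂ ℂ (fun x y => ∑ i, ∑ j, (x i * y j) • f i j)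
    (fun x x' y => by simp [add_mul, add_smul, Finset.sum_add_distrib])
    (fun c x y => by simp [Finset.smul_sum, mul_assoc, mul_smul])
    (fun x y y' => by simp [mul_add, add_smul, Finset.sum_add_distrib])
    (fun c x y => by simp [Finset.smul_sum, mul_smul, mul_left_comm])

/-- The bracket `μ0` of `L_{n,m}` on the even part. -/
def mu0 (n : ℕ) : V0 n →ₗ[ℂ] V0 n →ₗ[ℂ] V0 n :=
  bil fun i j =>
    if (i : ℕ) = 0 ∧ 1 ≤ (j : ℕ) then Xz n (((j : ℕ) : ℤ) + 1)
    else if (j : ℕ) = 0 ∧ 1 ≤ (i : ℕ) then -Xz n (((i : ℕ) : ℤ) + 1)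
    else 0

/-- The bracket `ρ0` of `L_{n,m}` between the even and the odd part. -/
def rho0 (n m : ℕ) : V0 n →ₗ[ℂ] V1 m →ₗ[ℂ] V1 m :=
  bil fun i j => if (i : ℕ) = 0 then Yb m ((j : ℕ) + 2) else 0


/-- Pinned instance for the space of bilinear maps `V0 × V1 → V1`. -/
instance (priority := 5000) instAddCommGroupBilRho (n m : ℕ) :
    AddCommGroup (V0 n →ₗ[ℂ] V1 m →ₗ[ℂ] V1 m) := LinearMap.addCommGroup

/-- Pinned instance for the space of bilinear maps `V0 × V1 → V1`. -/
instance (priority := 5000) instModuleBilRho (n m : ℕ) :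
    Module ℂ (V0 n →ₗ[ℂ] V1 m →ₗ[ℂ] V1 m) := LinearMap.module

/-- Pinned instance for the space of bilinear maps `V1 × V1 → V0`. -/
instance (priority := 5000) instAddCommGroupBilB (n m : ℕ) :
    AddCommGroup (V1 m →ₗ[ℂ] V1 m →ₗ[ℂ] V0 n) := LinearMap.addCommGroup

/-- Pinned instance for the space of bilinear maps `V1 × V1 → V0`. -/
instance (priority := 5000) instModuleBilB (n m : ℕ) :
    Module ℂ (V1 m →ₗ[ℂ] V1 m →ₗ[ℂ] V0 n) := LinearMap.module
/-- `ρ` is a ρ-cocycle of `L_{n,m}`. -/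
def IsRhoCocycle (n m : ℕ) (ρ : V0 n →ₗ[ℂ] V1 m →ₗ[ℂ] V1 m) : Prop :=
  ∀ (g g' : V0 n) (h : V1 m),
    ρ (mu0 n g g') h + ρ g' (rho0 n m g h) - ρ g (rho0 n m g' h)
      - rho0 n m g (ρ g' h) + rho0 n m g' (ρ g h) = 0

/-- `b` is a b-cocycle of `L_{n,m}` : it is symmetric and satisfies (R1) and (R2). -/
def IsBCocycle (n m : ℕ) (b : V1 m →ₗ[ℂ] V1 m →ₗ[ℂ] V0 n) : Prop :=
  (∀ h h', b h h' = b h' h) ∧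
  (∀ (g : V0 n) (h h' : V1 m),
    b (rho0 n m g h) h' + b (rho0 n m g h') h - mu0 n g (b h h') = 0) ∧
  (∀ h h' h'' : V1 m,
    rho0 n m (b h h') h'' + rho0 n m (b h'' h') h + rho0 n m (b h'' h) h' = 0)

/-- `b` satisfies relation (R3). -/
def SatR3 (n m : ℕ) (b : V1 m →ₗ[ℂ] V1 m →ₗ[ℂ] V0 n) : Prop :=
  ∀ t r : ℕ, 1 ≤ t → t ≤ m - 1 → 1 ≤ r → r ≤ m - 1 →
    mu0 n (Xb n 0) (b (Yb m t) (Yb m r)) = b (Yb m (t + 1)) (Yb m r) + b (Yb m (r + 1)) (Yb m t)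

/-- Membership in the space `E`: symmetric, satisfies (R3), and `b(Y_m,Y_m) ∈ ℂ·X_n`. -/
def MemE (n m : ℕ) (b : V1 m →ₗ[ℂ] V1 m →ₗ[ℂ] V0 n) : Prop :=
  (∀ h h', b h h' = b h' h) ∧ SatR3 n m b ∧ ∃ c : ℂ, b (Yb m m) (Yb m m) = c • Xb n n
/-- The ρ-cocycle `ϱ_{i,j}` with `ϱ_{i,j}(X_0, Y_i) = Y_j` and all other values zero. -/
def varrho (n m i j : ℕ) : V0 n →ₗ[ℂ] V1 m →ₗ[ℂ] V1 m :=
  bil fun a b' => if (a : ℕ) = 0 ∧ (b' : ℕ) + 1 = i then Yb m j else 0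

/-- The ρ-cocycle `ρ_{k,s}`. -/
def rhoKS (n m k s : ℕ) : V0 n →ₗ[ℂ] V1 m →ₗ[ℂ] V1 m :=
  bil fun a b' =>
    if 1 ≤ (a : ℕ) ∧ (k : ℤ) - ((b' : ℕ) + 1) + 1 ≤ (a : ℕ) ∧ (a : ℕ) ≤ k then
      (((-1 : ℂ) ^ (k - (a : ℕ))) * (Nat.choose ((b' : ℕ) + 1 - 1) (k - (a : ℕ)) : ℂ)) •
        Yb m (s + ((b' : ℕ) + 1) - 1 + (a : ℕ) - k)
    else 0

/-- A bilinear map supported on the first basis vector of `V0` only sees the coordinate `x 0`. -/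
lemma bil_eq_smul_of_support {n m : ℕ} {f : Fin (n + 1) → Fin m → V1 m}
    (hf : ∀ a b, a ≠ 0 → f a b = 0) (x : V0 n) (y : V1 m) :
    bil f x y = x 0 • bil f (Pi.single 0 1) y := by
  have key : ∀ z : V0 n, bil f z y = ∑ b, (z 0 * y b) • f 0 b := fun z => by
    rw [bil, LinearMap.mk₂_apply]
    refine Finset.sum_eq_single 0 (fun a _ ha => Finset.sum_eq_zero fun b _ => ?_) (by simp)
    rw [hf a b ha, smul_zero]
  simp [key, Finset.smul_sum, mul_smul]

/-- The vectors `Xz n k` have no component along `X_0`. -/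
lemma Xz_apply_zero (n : ℕ) (k : ℤ) : Xz n k 0 = 0 := by
  unfold Xz
  split_ifs with h
  · refine Pi.single_eq_of_ne (fun h0 => ?_) _
    have := congrArg Fin.val h0
    simp only [Fin.val_zero] at this
    omega
  · rfl

/-- Brackets of even elements have no component along `X_0`. -/
lemma mu0_apply_zero (n : ℕ) (x y : V0 n) : mu0 n x y 0 = 0 := by
  simp only [mu0, bil, LinearMap.mk₂_apply, Finset.sum_apply, Pi.smul_apply]
  refine Finset.sum_eq_zero fun a _ => Finset.sum_eq_zero fun b _ => ?_
  split_ifs <;> simp [Xz_apply_zero]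

/-- For `1 ≤ i, j ≤ m`, the bilinear map `ϱ_{i,j}` is a ρ-cocycle of `L_{n,m}`. -/
theorem varrho_is_rho_cocycle (n m : ℕ) (hn : 1 ≤ n) (hm : 1 ≤ m)
    (i j : ℕ) (hi1 : 1 ≤ i) (hi2 : i ≤ m) (hj1 : 1 ≤ j) (hj2 : j ≤ m) :
    IsRhoCocycle n m (varrho n m i j) := by
  have hv : ∀ (x : V0 n) (y : V1 m),
      varrho n m i j x y = x 0 • varrho n m i j (Pi.single 0 1) y :=
    bil_eq_smul_of_support fun a b ha => if_neg fun h => ha (Fin.ext h.1)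
  have hr : ∀ (x : V0 n) (y : V1 m), rho0 n m x y = x 0 • rho0 n m (Pi.single 0 1) y :=
    bil_eq_smul_of_support fun a b ha => if_neg fun h => ha (Fin.ext h)
  intro g g' h
  rw [hv (mu0 n g g'), hv g', hv g, hv g', hv g, hr g h, hr g' h, hr g, hr g', mu0_apply_zero]
  simp only [map_smul, smul_smul, zero_smul, mul_comm (g' 0)]
  abel

end
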